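/- Fix ε>0 and set R=N/4, Q=N/8. Let θ ∈ T and 0 < c < 1, and suppose that |Σ_{f∈G_N} (Λ'(f) − Λ_R(f)) e(fθ')| ≪ N^{O(1)}·2^{cN} for every θ' of the form θ+λ with λ having squarefree denominator of degree ≤ Q. Then |Σ_{f∈G_N} (Ψ(f) − Ψ'(f)) e(fθ)| ≪ N^{O(1)}·2^{cN+Q}. -/

import Mathlib

open Polynomial
open scoped Classical

noncomputable section

abbrev F2 := ZMod 2
abbrev Kinf := LaurentSeries F2
def polyToK (f : F2[X]) : Kinf :=
  ∑ i ∈ f.support, HahnSeries.single (-(i : ℤ)) (f.coeff i)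
def ordK (a : Kinf) : WithBot ℤ := if a = 0 then ⊥ else (↑(-a.order) : WithBot ℤ)
def eKr (a : Kinf) : ℝ := (-1 : ℝ) ^ ((a.coeff 1).val)
def eK (a : Kinf) : ℂ := ((eKr a : ℝ) : ℂ)
def InT (θ : Kinf) : Prop := ordK θ ≤ ((-1 : ℤ) : WithBot ℤ)
def GN (N : ℕ) : Finset F2[X] :=
  Set.Finite.toFinset (s := {f : F2[X] | f.degree < (N : ℕ)}) (by
    have h : {f : F2[X] | f.degree < (N : ℕ)} = ↑(Polynomial.degreeLT F2 N) := by
      ext f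
      simp [Polynomial.mem_degreeLT]
    rw [h]
    have : Finite (Polynomial.degreeLT F2 N) :=
      Finite.of_equiv _ (Polynomial.degreeLTEquiv F2 N).symm.toEquiv
    exact (Polynomial.degreeLT F2 N : Set F2[X]).toFinite)
def ratK (u s : F2[X]) : Kinf := polyToK u * (polyToK s)⁻¹

/-- τ(f): the number of divisors of `f`. -/
def tau (f : F2[X]) : ℕ := ((GN (f.natDegree + 1)).filter (fun g => g ∣ f)).card

/-- φ(f): the number of invertible residues modulo `f`. -/
def phi (f : F2[X]) : ℕ := ((GN f.natDegree).filter (fun g => IsCoprime g f)).card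

/-- ω(f): the number of (irreducible nonconstant, i.e. prime) divisors of `f`. -/
def omegaP (f : F2[X]) : ℕ :=
  ((GN (f.natDegree + 1)).filter (fun r => Irreducible r ∧ r ∣ f)).card

/-- The Möbius function on `F₂[x]`. -/
def mu (f : F2[X]) : ℤ := if Squarefree f then (-1) ^ (omegaP f) else 0

/-- The set of invertible residues modulo `s` (canonical representatives of
`(F₂[x]/(s))^×`, i.e. polynomials of degree `< deg s` coprime to `s`). -/
def residues (s : F2[X]) : Finset F2[X] := (GN s.natDegree).filter (fun t => IsCoprime t s)

/-- `α(s) = μ(s)/φ(s)`. -/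
def alphaA (s : F2[X]) : ℝ := (mu s : ℝ) / (phi s : ℝ)

/-- `α'(s) = ∏_{r | s prime} 3/(2^{deg r}+3)` for `s` squarefree, `0` otherwise. -/
def alphaB (s : F2[X]) : ℝ :=
  if Squarefree s then
    ∏ r ∈ (GN (s.natDegree + 1)).filter (fun r => Irreducible r ∧ r ∣ s),
      (3 : ℝ) / ((2 : ℝ) ^ r.natDegree + 3)
  else 0

/-- `Λ_M(f) = Σ_{s ∈ G_M} α(s) Σ_{t ∈ (F₂[x]/(s))^×} e(f t s⁻¹)`. -/
def LambdaM (M : ℕ) (f : F2[X]) : ℝ :=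
  ∑ s ∈ GN M, alphaA s * ∑ t ∈ residues s, eKr (polyToK f * ratK t s)

/-- `H_M(f) = Σ_{s ∈ G_M} α'(s) Σ_{t ∈ (F₂[x]/(s))^×} e(f t s⁻¹)`. -/
def HM (M : ℕ) (f : F2[X]) : ℝ :=
  ∑ s ∈ GN M, alphaB s * ∑ t ∈ residues s, eKr (polyToK f * ratK t s)

/-- `Λ'(f) = deg f` if `f` is prime, `0` otherwise. -/
def LambdaP (f : F2[X]) : ℝ := if Irreducible f then (f.natDegree : ℝ) else 0

/-- `Ψ(f) = Λ'(f+1) H_Q(f) 1_{f ∈ G_N}`. -/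
def Psi (N Q : ℕ) (f : F2[X]) : ℝ :=
  LambdaP (f + 1) * HM Q f * (if f ∈ GN N then 1 else 0)

/-- `Ψ'(f) = Λ_R(f+1) H_Q(f) 1_{f ∈ G_N}`. -/
def Psi' (N R Q : ℕ) (f : F2[X]) : ℝ :=
  LambdaM R (f + 1) * HM Q f * (if f ∈ GN N then 1 else 0)

/-- `Λ_r(f)` for a single prime `r`. -/
def Lambda_r (r f : F2[X]) : ℝ :=
  if r ∣ f then 0 else (2 : ℝ) ^ r.natDegree / ((2 : ℝ) ^ r.natDegree - 1)

/-- `τ²_r(f)` for a single prime `r`. -/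
def tauSq_r (r f : F2[X]) : ℝ :=
  if r ∣ f then 4 * (2 : ℝ) ^ r.natDegree / ((2 : ℝ) ^ r.natDegree + 3)
  else (2 : ℝ) ^ r.natDegree / ((2 : ℝ) ^ r.natDegree + 3)

/-- `˜Λ_M(f) = ∏_{r ∈ G_M prime} Λ_r(f)`. -/
def LambdaTilde (M : ℕ) (f : F2[X]) : ℝ :=
  ∏ r ∈ (GN M).filter (fun r => Irreducible r), Lambda_r r f

/-- `˜H_M(f) = ∏_{r ∈ G_M prime} τ²_r(f)`. -/
def HTilde (M : ℕ) (f : F2[X]) : ℝ :=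
  ∏ r ∈ (GN M).filter (fun r => Irreducible r), tauSq_r r f

/-- The element of `K∞` determined by a rational function (with `x ↦ t⁻¹`). -/
def ratToK (l : RatFunc F2) : Kinf := polyToK l.num * (polyToK l.denom)⁻¹

/-- `c : F₂(x)/F₂[x] → ℝ` (encoded on the canonical representatives
`λ = num/denom` in lowest terms with `deg num < deg denom`) is the system of Fourier
coefficients of `F : F₂[x] → ℝ`, i.e. `F(f) = Σ_λ c(λ) e(λ f)`. -/
def IsFourierCoeffs (F : F2[X] → ℝ) (c : RatFunc F2 → ℝ) : Prop :=
  (Function.support c).Finite ∧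
  (∀ l : RatFunc F2, c l ≠ 0 → (l.num).degree < (l.denom).degree) ∧
  ∀ f : F2[X], F f = ∑ᶠ l : RatFunc F2, c l * eKr (ratToK l * polyToK f)

/-- The canonical representative (mod `F₂[x]`) of a rational function. -/
def fracRat (l : RatFunc F2) : RatFunc F2 :=
  l - algebraMap F2[X] (RatFunc F2) (l.num / l.denom)

/-- `c(n, η)` from the statement of the exponential sum estimate for `Λ'`. -/
def cFun (n : ℕ) (η : Kinf) : ℝ :=
  if ordK η < ((-(n : ℤ) - 1 : ℤ) : WithBot ℤ) then 1
  else if ordK η = ((-(n : ℤ) - 1 : ℤ) : WithBot ℤ) then -1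
  else 0

/-- The class `C_B(X)` (with explicit implied constant `Cst`): functions whose Fourier
coefficients are supported on `λ` with squarefree denominator of degree `≤ X` and satisfy
`|c(λ)| ≤ Cst · τ(denom λ)^B / 2^{deg (denom λ)}`. -/
def InClassC (B X : ℕ) (Cst : ℝ) (F : F2[X] → ℝ) : Prop :=
  ∃ c : RatFunc F2 → ℝ, IsFourierCoeffs F c ∧
    (∀ l : RatFunc F2, c l ≠ 0 → Squarefree l.denom ∧ (l.denom).natDegree ≤ X) ∧
    (∀ l : RatFunc F2, |c l| ≤ Cst * (tau l.denom : ℝ) ^ B / 2 ^ (l.denom).natDegree)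

/-- The fractional part `‖θ‖` of `θ ∈ K∞`: keep exactly the coefficients of `x^{-n}`, `n ≥ 1`. -/
def fracK (θ : Kinf) : Kinf :=
  ⟨fun n => if 1 ≤ n then θ.coeff n else 0, by
    apply θ.isPWO_support'.mono
    intro n hn
    simp only [Function.mem_support, ne_eq] at hn ⊢
    intro h
    apply hn
    split_ifs
    · exact h
    · rfl⟩

lemma eKr_add (a b : Kinf) : eKr (a + b) = eKr a * eKr b := by
  unfold eKr
  rw [HahnSeries.coeff_add]
  rw [ZMod.val_add, ← neg_one_pow_eq_pow_mod_two, pow_add]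

lemma abs_eKr (a : Kinf) : |eKr a| = 1 := by
  unfold eKr
  simp [abs_pow]

lemma mem_GN {N : ℕ} {f : F2[X]} : f ∈ GN N ↔ f.degree < (N : ℕ) := by
  simp [GN]

lemma polyToK_eq (f : F2[X]) :
    polyToK f = Polynomial.aeval (HahnSeries.single (-1 : ℤ) (1 : F2) : Kinf) f := by
  rw [Polynomial.aeval_def, Polynomial.eval₂_eq_sum, Polynomial.sum, polyToK]
  refine Finset.sum_congr rfl fun i _ => ?_
  rw [HahnSeries.single_pow]
  have h01 : ∀ u : F2, u = 0 ∨ u = 1 := by decide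
  rcases h01 (f.coeff i) with h | h <;> rw [h] <;> simp

lemma polyToK_add (f g : F2[X]) : polyToK (f + g) = polyToK f + polyToK g := by
  simp [polyToK_eq]
lemma polyToK_mul (f g : F2[X]) : polyToK (f * g) = polyToK f * polyToK g := by
  simp [polyToK_eq]
lemma polyToK_one : polyToK 1 = 1 := by
  simp [polyToK_eq]

lemma polyToK_ne_zero {f : F2[X]} (hf : f ≠ 0) : polyToK f ≠ 0 := by
  intro h
  have h2 : (polyToK f).coeff (-(f.natDegree : ℤ)) = f.coeff f.natDegree := by
    unfold polyToK
    rw [HahnSeries.coeff_sum]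
    rw [Finset.sum_eq_single f.natDegree]
    · simp
    · intro b _ hb
      rw [HahnSeries.coeff_single_of_ne]
      intro h; apply hb; omega
    · intro h
      simp at h
      simp [h]
  rw [h] at h2
  simp at h2
  exact hf (Polynomial.leadingCoeff_eq_zero.1 h2.symm)

lemma ratK_eq (t s : F2[X]) (hs : s ≠ 0) :
    ratK t s = ratToK (algebraMap F2[X] (RatFunc F2) t / algebraMap F2[X] (RatFunc F2) s) := by
  unfold ratK ratToK
  set l := algebraMap F2[X] (RatFunc F2) t / algebraMap F2[X] (RatFunc F2) s with hl
  have hd := RatFunc.denom_ne_zero l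
  have h1 := RatFunc.num_div_denom l
  have hs' : algebraMap F2[X] (RatFunc F2) s ≠ 0 := RatFunc.algebraMap_ne_zero hs
  have hd' : algebraMap F2[X] (RatFunc F2) l.denom ≠ 0 := RatFunc.algebraMap_ne_zero hd
  have h2 : l.num * s = t * l.denom := by
    apply RatFunc.algebraMap_injective F2
    rw [map_mul, map_mul]
    rw [hl] at h1
    rw [← hl] at h1
    rw [← div_eq_div_iff hd' hs', h1]
  rw [← div_eq_mul_inv, ← div_eq_mul_inv, div_eq_div_iff (polyToK_ne_zero hs) (polyToK_ne_zero hd),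
    ← polyToK_mul, ← polyToK_mul, h2]

lemma card_GN (N : ℕ) : (GN N).card = 2 ^ N := by
  have e : {f // f ∈ GN N} ≃ Polynomial.degreeLT F2 N :=
    Equiv.subtypeEquivRight (fun f => by rw [mem_GN, Polynomial.mem_degreeLT])
  have e2 := e.trans (Polynomial.degreeLTEquiv F2 N).toEquiv
  have := Fintype.card_congr e2
  simpa using this

/-- prime divisors -/
def PD (s : F2[X]) : Finset F2[X] :=
  (GN (s.natDegree + 1)).filter (fun r => Irreducible r ∧ r ∣ s)

lemma mem_PD {s r : F2[X]} (hs : s ≠ 0) : r ∈ PD s ↔ Irreducible r ∧ r ∣ s := by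
  unfold PD
  rw [Finset.mem_filter, mem_GN]
  refine ⟨fun h => h.2, fun h => ⟨?_, h⟩⟩
  have := Polynomial.natDegree_le_of_dvd h.2 hs
  refine lt_of_le_of_lt Polynomial.degree_le_natDegree ?_
  exact_mod_cast Nat.lt_succ_of_le this

lemma monic2 {f : F2[X]} (hf : f ≠ 0) : f.Monic := by
  have h : f.leadingCoeff ≠ 0 := by simpa using hf
  unfold Polynomial.Monic
  generalize f.leadingCoeff = u at *
  fin_cases u
  · exact absurd rfl h
  · rfl

lemma assoc_eq {f g : F2[X]} (hf : f ≠ 0) (h : Associated f g) : f = g := by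
  have hg : g ≠ 0 := fun h0 => hf (by rw [h0] at h; simpa using h)
  exact Polynomial.eq_of_monic_of_associated (monic2 hf) (monic2 hg) h

lemma prod_PD {s : F2[X]} (hs : Squarefree s) : ∏ r ∈ PD s, r = s := by
  have h0 : s ≠ 0 := hs.ne_zero
  have hP : PD s = (UniqueFactorizationMonoid.normalizedFactors s).toFinset := by
    ext r
    rw [mem_PD h0, Multiset.mem_toFinset, UniqueFactorizationMonoid.mem_normalizedFactors_iff' h0]
    constructor
    · rintro ⟨h1, h2⟩
      exact ⟨h1, (monic2 h1.ne_zero).normalize_eq_self, h2⟩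
    · rintro ⟨h1, -, h2⟩
      exact ⟨h1, h2⟩
  have hn := (UniqueFactorizationMonoid.squarefree_iff_nodup_normalizedFactors h0).1 hs
  have := UniqueFactorizationMonoid.prod_normalizedFactors h0
  rw [hP, Finset.prod, Multiset.toFinset_val, hn.dedup, Multiset.map_id']
  exact (assoc_eq h0 this.symm).symm

lemma alphaB_bound {s : F2[X]} (hs : Squarefree s) :
    alphaB s * 2 ^ s.natDegree ≤ 3 ^ (PD s).card := by
  have h0 : s ≠ 0 := hs.ne_zero
  have h1 : s.natDegree = ∑ r ∈ PD s, r.natDegree := by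
    conv_lhs => rw [← prod_PD hs]
    exact Polynomial.natDegree_prod _ _ (fun r hr => ((mem_PD h0).1 hr).1.ne_zero)
  have h2 : alphaB s = ∏ r ∈ PD s, (3 : ℝ) / ((2 : ℝ) ^ r.natDegree + 3) := by
    unfold alphaB PD
    rw [if_pos hs]
  rw [h2, h1, ← Finset.prod_pow_eq_pow_sum, ← Finset.prod_mul_distrib, ← Finset.prod_const]
  refine Finset.prod_le_prod (fun r _ => by positivity) (fun r _ => ?_)
  rw [div_mul_eq_mul_div, div_le_iff₀ (by positivity)]
  nlinarith [show (0 : ℝ) < 2 ^ r.natDegree by positivity]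

lemma alphaB_nonneg (s : F2[X]) : 0 ≤ alphaB s := by
  unfold alphaB
  split_ifs
  · exact Finset.prod_nonneg fun r _ => by positivity
  · exact le_rfl

def A3 (Q : ℕ) (s : F2[X]) : Finset (F2[X] × F2[X] × F2[X]) :=
  (GN Q ×ˢ GN Q ×ˢ GN Q).filter (fun p => p.1 * p.2.1 * p.2.2 = s)

def subP (s : F2[X]) (g : {r // r ∈ PD s} → Fin 3) (i : Fin 3) : F2[X] :=
  ∏ r ∈ (PD s).attach.filter (fun r => g r = i), (r : F2[X])

lemma subP_prod {s : F2[X]} (hs : Squarefree s) (g : {r // r ∈ PD s} → Fin 3) :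
    subP s g 0 * subP s g 1 * subP s g 2 = s := by
  have h := Finset.prod_fiberwise (PD s).attach g (fun r => (r : F2[X]))
  rw [Fin.prod_univ_three, Finset.prod_attach (PD s) (fun r => r), prod_PD hs] at h
  exact h

lemma dvd_subP {s : F2[X]} (hs : Squarefree s) (g : {r // r ∈ PD s} → Fin 3) (i : Fin 3)
    (r : {r // r ∈ PD s}) : (r : F2[X]) ∣ subP s g i ↔ g r = i := by
  have h0 : s ≠ 0 := hs.ne_zero
  have hr := ((mem_PD h0).1 r.2).1
  unfold subP
  constructor
  · intro h
    obtain ⟨q, hq, hd⟩ := (hr.prime.dvd_finsetProd_iff _).1 h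
    have hqi := ((mem_PD h0).1 q.2).1
    have := assoc_eq hr.ne_zero (hr.associated_of_dvd hqi hd)
    have h3 : r = q := Subtype.ext this
    rw [h3]
    exact (Finset.mem_filter.1 hq).2
  · intro h
    exact Finset.dvd_prod_of_mem (fun r : {r // r ∈ PD s} => (r : F2[X]))
      (Finset.mem_filter.2 ⟨Finset.mem_attach _ _, h⟩)

lemma dvd_mem_GN {Q : ℕ} {a s : F2[X]} (hs : s ≠ 0) (h : a ∣ s) (hQ : s ∈ GN Q) : a ∈ GN Q := by
  rw [mem_GN] at *
  exact lt_of_le_of_lt (Polynomial.degree_le_of_dvd h hs) hQ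

lemma pow_le_A3 {Q : ℕ} {s : F2[X]} (hs : Squarefree s) (hQ : s ∈ GN Q) :
    3 ^ (PD s).card ≤ (A3 Q s).card := by
  have h0 : s ≠ 0 := hs.ne_zero
  have : (Finset.univ : Finset ({r // r ∈ PD s} → Fin 3)).card = 3 ^ (PD s).card := by
    simp
  rw [← this]
  refine Finset.card_le_card_of_injOn (fun g => (subP s g 0, subP s g 1, subP s g 2)) ?_ ?_
  · intro g _
    have hp := subP_prod hs g
    simp only [A3, Finset.coe_filter, Set.mem_ofPred_eq, Finset.mem_product]
    refine ⟨⟨dvd_mem_GN h0 ?_ hQ, dvd_mem_GN h0 ?_ hQ, dvd_mem_GN h0 ?_ hQ⟩, hp⟩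
    · exact ⟨subP s g 1 * subP s g 2, hp.symm.trans (by ring)⟩
    · exact ⟨subP s g 0 * subP s g 2, hp.symm.trans (by ring)⟩
    · exact ⟨subP s g 0 * subP s g 1, hp.symm.trans (by ring)⟩
  · intro g _ g' _ h
    simp only [Prod.mk.injEq] at h
    funext r
    have key : ∀ i, subP s g i = subP s g' i := by
      intro i
      fin_cases i
      · exact h.1
      · exact h.2.1
      · exact h.2.2
    have h1 := (dvd_subP hs g (g r) r).2 rfl
    rw [key] at h1
    exact ((dvd_subP hs g' (g r) r).1 h1).symm

lemma sum_A3 (Q : ℕ) :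
    ∑ s ∈ (GN Q).filter (fun s => Squarefree s), (A3 Q s).card ≤ Q ^ 3 * (8 * 2 ^ Q) := by
  have hdis : (((GN Q).filter (fun s => Squarefree s) : Finset F2[X]) : Set F2[X]).PairwiseDisjoint
      (A3 Q) := by
    intro s _ s' _ hne
    refine Finset.disjoint_left.2 fun p hp hp' => hne ?_
    rw [← (Finset.mem_filter.1 hp).2, ← (Finset.mem_filter.1 hp').2]
  rw [← Finset.card_biUnion hdis]
  let I := (Finset.range Q ×ˢ Finset.range Q ×ˢ Finset.range Q).filter
    (fun p => p.1 + p.2.1 + p.2.2 < Q)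
  have hsub : ((GN Q).filter (fun s => Squarefree s)).biUnion (A3 Q) ⊆
      I.biUnion (fun p => GN (p.1 + 1) ×ˢ GN (p.2.1 + 1) ×ˢ GN (p.2.2 + 1)) := by
    intro p hp
    obtain ⟨s, hs, hp⟩ := Finset.mem_biUnion.1 hp
    obtain ⟨hsQ, hsq⟩ := Finset.mem_filter.1 hs
    have he := (Finset.mem_filter.1 hp).2
    have h0 : s ≠ 0 := hsq.ne_zero
    rw [← he] at h0
    have hc := right_ne_zero_of_mul h0
    have hab := left_ne_zero_of_mul h0
    have hb := right_ne_zero_of_mul hab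
    have ha := left_ne_zero_of_mul hab
    rw [← he, mem_GN, ← Polynomial.natDegree_lt_iff_degree_lt h0, Polynomial.natDegree_mul hab hc,
      Polynomial.natDegree_mul ha hb] at hsQ
    refine Finset.mem_biUnion.2 ⟨(p.1.natDegree, p.2.1.natDegree, p.2.2.natDegree), ?_, ?_⟩
    · simp only [I, Finset.mem_filter, Finset.mem_product, Finset.mem_range]
      omega
    · simp only [Finset.mem_product, mem_GN, ← Polynomial.natDegree_lt_iff_degree_lt ha,
        ← Polynomial.natDegree_lt_iff_degree_lt hb, ← Polynomial.natDegree_lt_iff_degree_lt hc]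
      omega
  refine (Finset.card_le_card hsub).trans (Finset.card_biUnion_le.trans ?_)
  have hI : I.card ≤ Q ^ 3 := by
    refine (Finset.card_filter_le _ _).trans ?_
    simp only [Finset.card_product, Finset.card_range]
    exact le_of_eq (by ring)
  refine (Finset.sum_le_card_nsmul I _ (8 * 2 ^ Q) ?_).trans ?_
  · intro p hp
    have := (Finset.mem_filter.1 hp).2
    simp only [Finset.card_product, card_GN]
    calc _ = 8 * 2 ^ (p.1 + p.2.1 + p.2.2) := by ring
      _ ≤ _ := by gcongr; norm_num
  · rw [smul_eq_mul]
    gcongr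

lemma card_residues (s : F2[X]) : (residues s).card ≤ 2 ^ s.natDegree := by
  rw [← card_GN]
  exact Finset.card_filter_le _ _

lemma weight_bound (Q : ℕ) :
    ∑ s ∈ GN Q, alphaB s * ((residues s).card : ℝ) ≤ (Q : ℝ) ^ 3 * (8 * 2 ^ Q) := by
  have h1 : ∑ s ∈ GN Q, alphaB s * ((residues s).card : ℝ) =
      ∑ s ∈ (GN Q).filter (fun s => Squarefree s), alphaB s * ((residues s).card : ℝ) := by
    rw [Finset.sum_filter]
    refine Finset.sum_congr rfl fun s _ => ?_
    split_ifs with h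
    · rfl
    · simp [alphaB, h]
  rw [h1]
  have h2 : ((∑ s ∈ (GN Q).filter (fun s => Squarefree s), (A3 Q s).card : ℕ) : ℝ) ≤
      ((Q ^ 3 * (8 * 2 ^ Q) : ℕ) : ℝ) := by exact_mod_cast sum_A3 Q
  push_cast at h2
  refine le_trans (Finset.sum_le_sum fun s hs => ?_) h2
  obtain ⟨hsQ, hsq⟩ := Finset.mem_filter.1 hs
  calc alphaB s * ((residues s).card : ℝ) ≤ alphaB s * 2 ^ s.natDegree := by
        refine mul_le_mul_of_nonneg_left ?_ (alphaB_nonneg s)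
        exact_mod_cast card_residues s
    _ ≤ 3 ^ (PD s).card := alphaB_bound hsq
    _ ≤ _ := by exact_mod_cast pow_le_A3 hsq hsQ

lemma add_one_mem {N : ℕ} (hN : 1 ≤ N) {f : F2[X]} (hf : f ∈ GN N) : f + 1 ∈ GN N := by
  rw [mem_GN] at *
  refine lt_of_le_of_lt (Polynomial.degree_add_le _ _) (max_lt hf ?_)
  rw [Polynomial.degree_one]
  exact_mod_cast hN

lemma add_one_add_one (f : F2[X]) : f + 1 + 1 = f := by
  rw [add_assoc, CharTwo.add_self_eq_zero, add_zero]

lemma main_bound (N R Q : ℕ) (hN : 1 ≤ N) (θ : Kinf) (B : ℝ)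
    (h : ∀ l : RatFunc F2, Squarefree l.denom → (l.denom).natDegree ≤ Q →
      |∑ f ∈ GN N, (LambdaP f - LambdaM R f) * eKr (polyToK f * (θ + ratToK l))| ≤ B) :
    |∑ f ∈ GN N, (Psi N Q f - Psi' N R Q f) * eKr (polyToK f * θ)| ≤
      B * ((Q : ℝ) ^ 3 * (8 * 2 ^ Q)) := by
  have hB : 0 ≤ B := by
    refine le_trans (abs_nonneg _) (h 0 ?_ ?_)
    · simp
    · simp
  have e1 : ∑ f ∈ GN N, (Psi N Q f - Psi' N R Q f) * eKr (polyToK f * θ) =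
      ∑ g ∈ GN N, (LambdaP g - LambdaM R g) * HM Q (g + 1) * eKr (polyToK (g + 1) * θ) := by
    refine Finset.sum_bij' (fun f _ => f + 1) (fun f _ => f + 1) (fun f hf => add_one_mem hN hf)
      (fun f hf => add_one_mem hN hf) (fun f _ => add_one_add_one f)
      (fun f _ => add_one_add_one f) ?_
    intro f hf
    simp only [add_one_add_one, Psi, Psi', if_pos hf]
    ring
  have e2 : ∑ g ∈ GN N, (LambdaP g - LambdaM R g) * HM Q (g + 1) * eKr (polyToK (g + 1) * θ) =
      ∑ s ∈ GN Q, alphaB s * ∑ t ∈ residues s, eKr (ratK t s) * eKr θ *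
        ∑ g ∈ GN N, (LambdaP g - LambdaM R g) * eKr (polyToK g * (θ + ratK t s)) := by
    simp only [HM, Finset.mul_sum, Finset.sum_mul]
    rw [Finset.sum_comm]
    refine Finset.sum_congr rfl fun s _ => ?_
    rw [Finset.sum_comm]
    refine Finset.sum_congr rfl fun t _ => Finset.sum_congr rfl fun g _ => ?_
    simp only [polyToK_add, polyToK_one, add_mul, mul_add, one_mul, eKr_add]
    ring
  rw [e1, e2]
  refine le_trans (Finset.abs_sum_le_sum_abs _ _) ?_
  refine le_trans ?_ (mul_le_mul_of_nonneg_left (weight_bound Q) hB)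
  rw [Finset.mul_sum]
  refine Finset.sum_le_sum fun s hs => ?_
  by_cases hsq : Squarefree s
  · rw [abs_mul, abs_of_nonneg (alphaB_nonneg s), mul_left_comm]
    refine mul_le_mul_of_nonneg_left ?_ (alphaB_nonneg s)
    refine le_trans (Finset.abs_sum_le_sum_abs _ _) ?_
    rw [mul_comm, ← nsmul_eq_mul]
    refine Finset.sum_le_card_nsmul _ _ _ fun t _ => ?_
    rw [abs_mul, abs_mul, abs_eKr, abs_eKr, one_mul, one_mul, ratK_eq t s hsq.ne_zero]
    have hd := RatFunc.denom_div_dvd t s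
    refine h _ (hsq.squarefree_of_dvd hd) ?_
    refine (Polynomial.natDegree_le_of_dvd hd hsq.ne_zero).trans ?_
    rw [mem_GN, ← Polynomial.natDegree_lt_iff_degree_lt hsq.ne_zero] at hs
    exact hs.le
  · simp [alphaB, hsq]

/-- With `R = N/4`, `Q = N/8`: if `0 < c < 1` and
`|Σ_{f∈G_N} (Λ′(f) − Λ_R(f)) e(fθ′)| ≪ N^{O(1)} 2^{cN}` for every `θ′ = θ + λ` with `λ`
having squarefree denominator of degree `≤ Q`, then
`|Σ_{f∈G_N} (Ψ(f) − Ψ′(f)) e(fθ)| ≪ N^{O(1)} 2^{cN+Q}`. -/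
theorem statement_9 (c : ℝ) (hc0 : 0 < c) (hc1 : c < 1) (C₁ D₁ : ℝ) :
    ∃ C₂ D₂ : ℝ, ∀ N : ℕ, 1 ≤ N → ∀ θ : Kinf, InT θ →
      (∀ l : RatFunc F2, Squarefree l.denom → (l.denom).natDegree ≤ N / 8 →
        |∑ f ∈ GN N, (LambdaP f - LambdaM (N / 4) f) * eKr (polyToK f * (θ + ratToK l))| ≤
          C₁ * (N : ℝ) ^ D₁ * (2 : ℝ) ^ (c * (N : ℝ))) →
      |∑ f ∈ GN N, (Psi N (N / 8) f - Psi' N (N / 4) (N / 8) f) * eKr (polyToK f * θ)| ≤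
        C₂ * (N : ℝ) ^ D₂ * (2 : ℝ) ^ (c * (N : ℝ) + ((N / 8 : ℕ) : ℝ)) := by
  refine ⟨8 * C₁, D₁ + 3, fun N hN θ _ h => ?_⟩
  refine (main_bound N (N / 4) (N / 8) hN θ _ h).trans ?_
  have hB : 0 ≤ C₁ * (N : ℝ) ^ D₁ * (2 : ℝ) ^ (c * (N : ℝ)) :=
    le_trans (abs_nonneg _) (h 0 (by simp) (by simp))
  have hN0 : (0 : ℝ) < N := by exact_mod_cast hN
  have hQ : ((N / 8 : ℕ) : ℝ) ≤ N := by exact_mod_cast Nat.div_le_self N 8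
  rw [Real.rpow_add hN0, Real.rpow_add (by norm_num : (0 : ℝ) < 2), Real.rpow_natCast]
  calc _ ≤ C₁ * (N : ℝ) ^ D₁ * (2 : ℝ) ^ (c * (N : ℝ)) * ((N : ℝ) ^ 3 * (8 * 2 ^ (N / 8))) := by
        gcongr
    _ = _ := by
        rw [show ((3 : ℝ)) = ((3 : ℕ) : ℝ) by norm_num, Real.rpow_natCast]
        ring
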